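/- Let d ≥ 1, a_X, a_Y ∈ ℝ^d, σ_X², σ_Y², τ² > 0, μ ∈ ℝ^d, L₁, L₂ probability measures on ℝ, and consider the model densities p(x|θ) = ∫ φ_d(x − θ − k a_X; σ_X² I_d) dL₁(k), q(y|θ) = ∫ φ_d(y − θ − j a_Y; σ_Y² I_d) dL₂(j), and prior π(θ) = φ_d(θ − μ; τ² I_d). Set ω := τ²/(τ² + σ_X²), A := ‖a_X‖²/(σ_X² + τ²), B := (x − μ)ᵀa_X/(σ_X² + τ²), and let G_{π,x} be the probability measure on ℝ with dG_{π,x}(k) = e^{−Ak²/2 + Bk} dL₁(k) / ∫ e^{−Au²/2 + Bu} dL₁(u) (assumed finite and positive). Then the Bayes predictive density q̂_π(y; x) := ∫ q(y|θ) p(x|θ) π(θ) dθ / ∫ p(x|θ) π(θ) dθ satisfies, for all y ∈ ℝ^d: q̂_π(y; x) = ∫_ℝ∫_ℝ φ_d( y − ωx − (1−ω)μ + ω k a_X − j a_Y ; (ω σ_X² + σ_Y²) I_d ) dG_{π,x}(k) dL₂(j). -/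

import Mathlib

open MeasureTheory Matrix Real

/-- The centered `d`-variate normal density `φ_d(z; Σ)` with covariance matrix `S`. -/
noncomputable def mvn (d : ℕ) (S : Matrix (Fin d) (Fin d) ℝ) (z : Fin d → ℝ) : ℝ :=
  (2 * π) ^ (-(d : ℝ) / 2) * S.det ^ (-(1 : ℝ) / 2) * Real.exp (-(z ⬝ᵥ S⁻¹ *ᵥ z) / 2)

/-- The isotropic normal density in closed form. -/
theorem mvn_smul_one {d : ℕ} {s : ℝ} (hs : 0 < s) (z : Fin d → ℝ) :
    mvn d (s • (1 : Matrix (Fin d) (Fin d) ℝ)) z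
      = (2 * π * s) ^ (-(d : ℝ) / 2) * Real.exp (-(z ⬝ᵥ z) / (2 * s)) := by
  have hinv : (s • (1 : Matrix (Fin d) (Fin d) ℝ))⁻¹ = s⁻¹ • 1 := by
    apply Matrix.inv_eq_right_inv
    simp [smul_smul, hs.ne']
  have hdet : (s • (1 : Matrix (Fin d) (Fin d) ℝ)).det ^ (-(1 : ℝ) / 2) = s ^ (-(d : ℝ) / 2) := by
    rw [Matrix.det_smul, Matrix.det_one, mul_one, Fintype.card_fin, ← Real.rpow_natCast,
      ← Real.rpow_mul hs.le]
    congr 1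
    ring
  rw [mvn, hinv, hdet, Real.mul_rpow (by positivity) hs.le, smul_mulVec, one_mulVec,
    dotProduct_smul, smul_eq_mul]
  congr 2
  field_simp

theorem mvn_smul_one_nonneg {d : ℕ} {s : ℝ} (hs : 0 < s) (z : Fin d → ℝ) :
    0 ≤ mvn d (s • (1 : Matrix (Fin d) (Fin d) ℝ)) z := by
  rw [mvn_smul_one hs]
  positivity

theorem mvn_smul_one_le {d : ℕ} {s : ℝ} (hs : 0 < s) (z : Fin d → ℝ) :
    mvn d (s • (1 : Matrix (Fin d) (Fin d) ℝ)) z ≤ (2 * π * s) ^ (-(d : ℝ) / 2) := by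
  rw [mvn_smul_one hs]
  refine mul_le_of_le_one_right (by positivity) (Real.exp_le_one_iff.2 ?_)
  rw [neg_div, neg_nonpos]
  exact div_nonneg (Finset.sum_nonneg fun i _ => mul_self_nonneg _) (by positivity)

theorem continuous_mvn (d : ℕ) (S : Matrix (Fin d) (Fin d) ℝ) : Continuous (mvn d S) := by
  unfold mvn
  fun_prop

theorem integral_mvn_smul_one {d : ℕ} {s : ℝ} (hs : 0 < s) :
    ∫ z, mvn d (s • (1 : Matrix (Fin d) (Fin d) ℝ)) z = 1 := by
  have hexp (z : Fin d → ℝ) : Real.exp (-(z ⬝ᵥ z) / (2 * s))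
      = ∏ i, Real.exp (-(2 * s)⁻¹ * z i ^ 2) := by
    rw [← Real.exp_sum, dotProduct, ← Finset.mul_sum]
    simp_rw [← pow_two]
    congr 1
    ring
  simp_rw [mvn_smul_one hs, hexp, integral_const_mul]
  rw [integral_fintype_prod_volume_eq_pow (fun t : ℝ => Real.exp (-(2 * s)⁻¹ * t ^ 2)),
    integral_gaussian, Fintype.card_fin, div_inv_eq_mul, Real.sqrt_eq_rpow, ← Real.rpow_natCast,
    ← Real.rpow_mul (by positivity), show π * (2 * s) = 2 * π * s by ring,
    ← Real.rpow_add (by positivity), show -(d : ℝ) / 2 + 1 / 2 * d = 0 by ring, Real.rpow_zero]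

theorem integrable_mvn_smul_one {d : ℕ} {s : ℝ} (hs : 0 < s) :
    Integrable (mvn d (s • (1 : Matrix (Fin d) (Fin d) ℝ))) :=
  .of_integral_ne_zero (by simp [integral_mvn_smul_one hs])

/-- Completing the square in a product of two isotropic normal densities. -/
theorem mvn_mul_mvn {d : ℕ} {s t : ℝ} (hs : 0 < s) (ht : 0 < t) (u v θ : Fin d → ℝ) :
    mvn d (s • (1 : Matrix (Fin d) (Fin d) ℝ)) (u - θ)
        * mvn d (t • (1 : Matrix (Fin d) (Fin d) ℝ)) (θ - v)
      = mvn d ((s + t) • (1 : Matrix (Fin d) (Fin d) ℝ)) (u - v)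
        * mvn d ((t / (t + s) * s) • (1 : Matrix (Fin d) (Fin d) ℝ))
            (θ - ((t / (t + s)) • u + (1 - t / (t + s)) • v)) := by
  have hst : t + s ≠ 0 := by positivity
  have hconst : (2 * π * s) ^ (-(d : ℝ) / 2) * (2 * π * t) ^ (-(d : ℝ) / 2)
      = (2 * π * (s + t)) ^ (-(d : ℝ) / 2)
        * (2 * π * (t / (t + s) * s)) ^ (-(d : ℝ) / 2) := by
    rw [← Real.mul_rpow (by positivity) (by positivity),
      ← Real.mul_rpow (by positivity) (by positivity)]
    congr 1
    field_simp
    ring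
  rw [mvn_smul_one hs, mvn_smul_one ht, mvn_smul_one (by positivity),
    mvn_smul_one (by positivity), mul_mul_mul_comm _ (Real.exp _),
    mul_mul_mul_comm _ (Real.exp _), hconst, ← Real.exp_add, ← Real.exp_add]
  congr 2
  simp only [dotProduct, ← Finset.sum_neg_distrib, Finset.sum_div, ← Finset.sum_add_distrib]
  refine Finset.sum_congr rfl fun i _ => ?_
  simp only [Pi.sub_apply, Pi.add_apply, Pi.smul_apply, smul_eq_mul]
  have hst' : s + t ≠ 0 := by positivity
  field_simp
  ring

/-- Exponential tilting of an isotropic normal density under a shift of its argument. -/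
theorem mvn_sub_smul {d : ℕ} {s : ℝ} (hs : 0 < s) (z a : Fin d → ℝ) (k : ℝ) :
    mvn d (s • (1 : Matrix (Fin d) (Fin d) ℝ)) (z - k • a)
      = mvn d (s • (1 : Matrix (Fin d) (Fin d) ℝ)) z
        * Real.exp (-((a ⬝ᵥ a) / s) * k ^ 2 / 2 + (z ⬝ᵥ a) / s * k) := by
  rw [mvn_smul_one hs, mvn_smul_one hs, mul_assoc (_ ^ _), ← Real.exp_add]
  congr 2
  simp only [sub_dotProduct, dotProduct_sub, smul_dotProduct, dotProduct_smul, smul_eq_mul,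
    dotProduct_comm a z]
  field_simp
  ring

theorem integral_mvn_mul_mvn {d : ℕ} {s t : ℝ} (hs : 0 < s) (ht : 0 < t) (u v : Fin d → ℝ) :
    ∫ θ, mvn d (s • (1 : Matrix (Fin d) (Fin d) ℝ)) (u - θ)
        * mvn d (t • (1 : Matrix (Fin d) (Fin d) ℝ)) (θ - v)
      = mvn d ((s + t) • (1 : Matrix (Fin d) (Fin d) ℝ)) (u - v) := by
  simp_rw [mvn_mul_mvn hs ht, integral_const_mul]
  rw [integral_sub_right_eq_self (mvn d ((t / (t + s) * s) • (1 : Matrix (Fin d) (Fin d) ℝ))),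
    integral_mvn_smul_one (by positivity), mul_one]

theorem integrable_mvn_mul_mvn {d : ℕ} {s t : ℝ} (hs : 0 < s) (ht : 0 < t) (u v : Fin d → ℝ) :
    Integrable fun θ => mvn d (s • (1 : Matrix (Fin d) (Fin d) ℝ)) (u - θ)
        * mvn d (t • (1 : Matrix (Fin d) (Fin d) ℝ)) (θ - v) := by
  simp_rw [mvn_mul_mvn hs ht]
  exact ((integrable_mvn_smul_one (by positivity)).comp_sub_right _).const_mul _

theorem integrable_mul_mvn {d : ℕ} {α : Type*} [MeasurableSpace α] {ν : Measure α} {s : ℝ}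
    (hs : 0 < s) {w : α → ℝ} (hw : Integrable w ν) {u : α → Fin d → ℝ} (hu : Measurable u) :
    Integrable (fun a => w a * mvn d (s • (1 : Matrix (Fin d) (Fin d) ℝ)) (u a)) ν := by
  refine hw.mul_bdd (c := (2 * π * s) ^ (-(d : ℝ) / 2))
    ((continuous_mvn _ _).measurable.comp hu).aestronglyMeasurable (.of_forall fun a => ?_)
  rw [Real.norm_of_nonneg (mvn_smul_one_nonneg hs _)]
  exact mvn_smul_one_le hs _

/-- Smoothing the product of two isotropic normal densities, mixed over their centres. -/
theorem integral_integral_mvn_mul_mvn {d : ℕ} {α : Type*} [MeasurableSpace α] {ν : Measure α}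
    [SFinite ν] {s t : ℝ} (hs : 0 < s) (ht : 0 < t) {w : α → ℝ} (hw : Integrable w ν)
    (hw0 : ∀ a, 0 ≤ w a) {u v : α → Fin d → ℝ} (hu : Measurable u) (hv : Measurable v) :
    ∫ θ, ∫ a, w a * (mvn d (s • (1 : Matrix (Fin d) (Fin d) ℝ)) (u a - θ)
        * mvn d (t • (1 : Matrix (Fin d) (Fin d) ℝ)) (θ - v a)) ∂ν
      = ∫ a, w a * mvn d ((s + t) • (1 : Matrix (Fin d) (Fin d) ℝ)) (u a - v a) ∂ν := by
  have hmeas (r : ℝ) : Measurable (mvn d (r • (1 : Matrix (Fin d) (Fin d) ℝ))) :=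
    (continuous_mvn _ _).measurable
  rw [integral_integral_swap]
  · simp_rw [integral_const_mul, integral_mvn_mul_mvn hs ht]
  refine (integrable_prod_iff' ?_).2 ⟨.of_forall fun a => ?_, ?_⟩
  · refine AEStronglyMeasurable.mul hw.1.comp_snd (Measurable.aestronglyMeasurable ?_)
    exact ((hmeas s).comp ((hu.comp measurable_snd).sub measurable_fst)).mul
      ((hmeas t).comp (measurable_fst.sub (hv.comp measurable_snd)))
  · exact (integrable_mvn_mul_mvn hs ht (u a) (v a)).const_mul (w a)
  · have hnorm (θ : Fin d → ℝ) (a : α) :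
        ‖w a * (mvn d (s • (1 : Matrix (Fin d) (Fin d) ℝ)) (u a - θ)
          * mvn d (t • (1 : Matrix (Fin d) (Fin d) ℝ)) (θ - v a))‖
        = w a * (mvn d (s • (1 : Matrix (Fin d) (Fin d) ℝ)) (u a - θ)
          * mvn d (t • (1 : Matrix (Fin d) (Fin d) ℝ)) (θ - v a)) :=
      Real.norm_of_nonneg (mul_nonneg (hw0 a)
        (mul_nonneg (mvn_smul_one_nonneg hs _) (mvn_smul_one_nonneg ht _)))
    simp_rw [Function.uncurry_apply_pair, hnorm, integral_const_mul, integral_mvn_mul_mvn hs ht]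
    exact integrable_mul_mvn (add_pos hs ht) hw (hu.sub hv)

/-- the Bayes predictive density under a normal prior `N_d(μ, τ² I_d)` for the
MMN model is a two-direction mean mixture of normals:
`q̂_π(y; x) = ∫∫ φ_d(y − ωx − (1−ω)μ + ωk a_X − j a_Y; (ωσ_X² + σ_Y²) I_d) dG_{π,x}(k) dL₂(j)`. -/
theorem bayes_predictive_normal_prior
    (d : ℕ) (hd : 1 ≤ d) (aX aY μ : Fin d → ℝ)
    (sX2 sY2 τ2 : ℝ) (hX : 0 < sX2) (hY : 0 < sY2) (hτ : 0 < τ2)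
    (L₁ L₂ : Measure ℝ) [IsProbabilityMeasure L₁] [IsProbabilityMeasure L₂]
    (p q : (Fin d → ℝ) → (Fin d → ℝ) → ℝ)
    (hp : p = fun x θ => ∫ k, mvn d (sX2 • (1 : Matrix (Fin d) (Fin d) ℝ)) (x - θ - k • aX) ∂L₁)
    (hq : q = fun y θ => ∫ j, mvn d (sY2 • (1 : Matrix (Fin d) (Fin d) ℝ)) (y - θ - j • aY) ∂L₂)
    (prior : (Fin d → ℝ) → ℝ)
    (hprior : prior = fun θ => mvn d (τ2 • (1 : Matrix (Fin d) (Fin d) ℝ)) (θ - μ))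
    (x : Fin d → ℝ)
    (ω A B : ℝ) (hω : ω = τ2 / (τ2 + sX2))
    (hA : A = (aX ⬝ᵥ aX) / (sX2 + τ2)) (hB : B = ((x - μ) ⬝ᵥ aX) / (sX2 + τ2))
    (Z : ℝ) (hZ : Z = ∫ u, Real.exp (-A * u ^ 2 / 2 + B * u) ∂L₁)
    (hZInt : Integrable (fun u : ℝ => Real.exp (-A * u ^ 2 / 2 + B * u)) L₁)
    (hZpos : 0 < Z) :
    ∀ y : Fin d → ℝ,
      (∫ θ : Fin d → ℝ, q y θ * p x θ * prior θ) / (∫ θ : Fin d → ℝ, p x θ * prior θ)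
        = ∫ k, (∫ j, mvn d ((ω * sX2 + sY2) • (1 : Matrix (Fin d) (Fin d) ℝ))
              (y - ω • x - (1 - ω) • μ + (ω * k) • aX - j • aY) ∂L₂) *
            (Real.exp (-A * k ^ 2 / 2 + B * k) / Z) ∂L₁ := by
  intro y
  have hXτ : 0 < sX2 + τ2 := by positivity
  have hωX : 0 < ω * sX2 := by rw [hω]; positivity
  set C := mvn d ((sX2 + τ2) • (1 : Matrix (Fin d) (Fin d) ℝ)) (x - μ) with hC
  set w : ℝ → ℝ := fun k => Real.exp (-A * k ^ 2 / 2 + B * k) with hw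
  have hC0 : 0 < C := by rw [hC, mvn_smul_one hXτ]; positivity
  have htilt (k : ℝ) :
      mvn d ((sX2 + τ2) • (1 : Matrix (Fin d) (Fin d) ℝ)) (x - k • aX - μ) = C * w k := by
    rw [sub_right_comm, mvn_sub_smul hXτ, hw, hA, hB]
  have hjoint (k : ℝ) (θ : Fin d → ℝ) :
      mvn d (sX2 • (1 : Matrix (Fin d) (Fin d) ℝ)) (x - θ - k • aX) * prior θ
        = C * w k * mvn d ((ω * sX2) • (1 : Matrix (Fin d) (Fin d) ℝ))
            (θ - (ω • (x - k • aX) + (1 - ω) • μ)) := by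
    rw [hprior, sub_right_comm, mvn_mul_mvn hX hτ, htilt, hω]
  have hden : ∫ θ, p x θ * prior θ = C * Z := by
    have h := integral_integral_mvn_mul_mvn (ν := L₁) hX hτ (w := fun _ => 1)
      (u := fun k => x - k • aX) (v := fun _ => μ) (integrable_const 1) (fun _ => zero_le_one)
      (by fun_prop) (by fun_prop)
    simp_rw [one_mul, htilt, integral_const_mul] at h
    rw [hZ, ← h]
    simp_rw [hp, hprior, ← integral_mul_const, sub_right_comm x]
  have hnum : ∫ θ, q y θ * p x θ * prior θ
      = ∫ k, C * w k * ∫ j, mvn d ((ω * sX2 + sY2) • (1 : Matrix (Fin d) (Fin d) ℝ))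
          (y - ω • x - (1 - ω) • μ + (ω * k) • aX - j • aY) ∂L₂ ∂L₁ := by
    have hCw : Integrable (fun a : ℝ × ℝ => C * w a.1) (L₁.prod L₂) :=
      (hZInt.const_mul C).comp_fst L₂
    have h := integral_integral_mvn_mul_mvn hY hωX hCw (fun a => by positivity)
      (u := fun a => y - a.2 • aY) (v := fun a => ω • (x - a.1 • aX) + (1 - ω) • μ)
      (by fun_prop) (by fun_prop)
    have hcentre (k j : ℝ) : y - j • aY - (ω • (x - k • aX) + (1 - ω) • μ)
        = y - ω • x - (1 - ω) • μ + (ω * k) • aX - j • aY := by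
      module
    rw [integral_prod _ (integrable_mul_mvn (by positivity) hCw (by fun_prop))] at h
    simp_rw [integral_const_mul, hcentre, add_comm sY2] at h
    rw [← h]
    congr 1 with θ
    rw [mul_assoc, mul_comm, hp, ← integral_mul_const (prior θ), hq]
    simp_rw [hjoint]
    rw [← integral_prod_mul]
    congr 1 with a
    rw [sub_right_comm y]
    ring
  rw [hden, hnum, ← integral_div]
  congr 1 with k
  rw [mul_assoc, mul_div_mul_left _ _ hC0.ne', mul_comm (w k), mul_div_assoc]
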